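/- Suppose F satisfies the second-order tail conditions with α_R < 2 and α_L < 2. Then there are strictly positive finite constants C_R (depending only on c_R and α_R) and C_L (depending only on c_L and α_L) such that σ²(m/n, k/n) / [ C_R (k/n)^{1−2/α_R} + C_L (m/n)^{1−2/α_L} ] → 1 as n → ∞. -/

import Mathlib

open Filter Set Topology MeasureTheory

/-- The generalized inverse (quantile function) of a distribution function `F`:
`F⁻(u) = inf {x : F x ≥ u}`. -/
noncomputable def quantile (F : ℝ → ℝ) (u : ℝ) : ℝ := sInf {x : ℝ | u ≤ F x}

/-- The Lebesgue–Stieltjes measure associated to a nondecreasing function `g`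
(junk value `0` if `g` is not monotone). -/
noncomputable def lsMeasure (g : ℝ → ℝ) : Measure ℝ :=
  open scoped Classical in
  if hg : Monotone g then hg.stieltjesFunction.measure else 0

/-- The quantile function of `F` clamped to `[s, 1 - t]`: a nondecreasing function of `u`
that agrees with `F⁻` on `[s, 1 - t]`. -/
noncomputable def clampedQuantile (F : ℝ → ℝ) (s t u : ℝ) : ℝ :=
  quantile F (max s (min u (1 - t)))

/-- `σ²(s,t) = ∫_s^{1-t} ∫_s^{1-t} (u ∧ v - u v) dF⁻(u) dF⁻(v)`, the double
Lebesgue–Stieltjes integral over `(s, 1-t]` with respect to the nondecreasing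
function `F⁻`. -/
noncomputable def sigmaSq (F : ℝ → ℝ) (s t : ℝ) : ℝ :=
  ∫ u in Ioc s (1 - t), ∫ v in Ioc s (1 - t), (min u v - u * v)
    ∂(lsMeasure (clampedQuantile F s t)) ∂(lsMeasure (clampedQuantile F s t))

/-- Second-order right-tail condition: as `x → ∞`,
`1 - F x = c * x^(-α) * (1 + b * x^(-β) + o (x^(-β)))`. -/
def RightTailSecondOrder (F : ℝ → ℝ) (c α b β : ℝ) : Prop :=
  Tendsto (fun x : ℝ => ((1 - F x) / (c * x ^ (-α)) - 1) * x ^ β) atTop (nhds b)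

/-- Second-order left-tail condition: as `x → ∞`,
`F (-x) = c * x^(-α) * (1 + b * x^(-β) + o (x^(-β)))`. -/
def LeftTailSecondOrder (F : ℝ → ℝ) (c α b β : ℝ) : Prop :=
  Tendsto (fun x : ℝ => (F (-x) / (c * x ^ (-α)) - 1) * x ^ β) atTop (nhds b)

/-- `F` is a distribution function: nondecreasing, right-continuous, with limits
`0` at `-∞` and `1` at `+∞`. -/
structure IsDistributionFunction (F : ℝ → ℝ) : Prop where
  mono : Monotone F
  right_continuous : ∀ x : ℝ, ContinuousWithinAt F (Ici x) x
  tendsto_atTop : Tendsto F atTop (nhds 1)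
  tendsto_atBot : Tendsto F atBot (nhds 0)

/-- A second-order expansion implies the first-order one. -/
lemma tendsto_mul_rpow_of_secondOrder {T : ℝ → ℝ} {c α b β : ℝ} (hc : 0 < c) (hβ : 0 < β)
    (h : Tendsto (fun x : ℝ => (T x / (c * x ^ (-α)) - 1) * x ^ β) atTop (𝓝 b)) :
    Tendsto (fun x : ℝ => T x * x ^ α) atTop (𝓝 c) := by
  have h3 := ((h.mul (tendsto_rpow_neg_atTop hβ)).add_const 1).const_mul c
  rw [mul_zero, zero_add, mul_one] at h3
  refine h3.congr' ?_
  filter_upwards [eventually_gt_atTop 0] with x hx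
  have h1 : x ^ β ≠ 0 := (Real.rpow_pos_of_pos hx β).ne'
  have h2 : x ^ α ≠ 0 := (Real.rpow_pos_of_pos hx α).ne'
  rw [Real.rpow_neg hx.le, Real.rpow_neg hx.le]
  field_simp
  ring

/-- An antitone function with values in `[0, 1]` such that `G x * x ^ α → c` at infinity. -/
structure IsParetoTail (G : ℝ → ℝ) (c α : ℝ) : Prop where
  anti : Antitone G
  nonneg : ∀ x, 0 ≤ G x
  le_one : ∀ x, G x ≤ 1
  tendsto : Tendsto (fun x : ℝ => G x * x ^ α) atTop (𝓝 c)

namespace IsParetoTail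

variable {G : ℝ → ℝ} {c α : ℝ}

lemma exists_bound (h : IsParetoTail G c α) (hα : 0 < α) :
    ∃ M, 0 ≤ M ∧ ∀ x, 0 < x → G x ≤ M * x ^ (-α) := by
  have h1 : ∀ᶠ x in atTop, G x * x ^ α ≤ c + 1 :=
    h.tendsto.eventually (eventually_le_nhds (by linarith))
  obtain ⟨X, hX⟩ := eventually_atTop.1 h1
  refine ⟨max (c + 1) ((max X 0) ^ α),
    le_max_of_le_right (Real.rpow_nonneg (le_max_right _ _) _), fun x hx => ?_⟩
  have hxp : 0 < x ^ α := Real.rpow_pos_of_pos hx α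
  rw [Real.rpow_neg hx.le, ← div_eq_mul_inv, le_div_iff₀ hxp]
  rcases le_total X x with hXx | hXx
  · exact (hX x hXx).trans (le_max_left _ _)
  · refine le_max_of_le_right ?_
    calc G x * x ^ α ≤ 1 * x ^ α := by gcongr; exact h.le_one x
      _ = x ^ α := one_mul _
      _ ≤ _ := Real.rpow_le_rpow hx.le (hXx.trans (le_max_left _ _)) hα.le

lemma pos (h : IsParetoTail G c α) (hc : 0 < c) (x : ℝ) : 0 < G x := by
  have h1 : ∀ᶠ x in atTop, 0 < G x * x ^ α := h.tendsto.eventually (eventually_gt_nhds hc)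
  obtain ⟨y, ⟨hy, hy0⟩, hxy⟩ :=
    ((h1.and (eventually_gt_atTop 0)).and (eventually_ge_atTop x)).exists
  exact (pos_of_mul_pos_left hy (Real.rpow_nonneg hy0.le α)).trans_le (h.anti hxy)

lemma integrableOn_Ioi (h : IsParetoTail G c α) (hα : 1 < α) : IntegrableOn G (Ioi 0) := by
  obtain ⟨M, -, hM⟩ := h.exists_bound (by linarith)
  rw [← Ioc_union_Ioi_eq_Ioi zero_le_one]
  refine IntegrableOn.union ?_ ?_
  · exact (h.anti.antitoneOn _).integrableOn_isCompact isCompact_Icc |>.mono_set Ioc_subset_Icc_self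
  · refine ((integrableOn_Ioi_rpow_of_lt (a := -α) (by linarith) zero_lt_one).const_mul M).mono'
      h.anti.measurable.aestronglyMeasurable ?_
    refine (ae_restrict_iff' measurableSet_Ioi).2 (.of_forall fun x hx => ?_)
    rw [Real.norm_of_nonneg (h.nonneg x)]
    exact hM x (zero_lt_one.trans hx)

/-- Karamata's theorem for the truncated first moment of a Pareto-type tail. -/
lemma tendsto_integral_mul (h : IsParetoTail G c α) (hα : 0 < α) (hα2 : α < 2) :
    Tendsto (fun B : ℝ => (∫ y in (0 : ℝ)..B, y * G y) / B ^ (2 - α)) atTop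
      (𝓝 (c / (2 - α))) := by
  obtain ⟨M, hM0, hM⟩ := h.exists_bound hα
  have key : Tendsto (fun B : ℝ => ∫ x in (0 : ℝ)..1, x * (G (B * x) * B ^ α)) atTop
      (𝓝 (∫ x in (0 : ℝ)..1, c * x ^ (1 - α))) := by
    refine intervalIntegral.tendsto_integral_filter_of_dominated_convergence
      (fun x => M * x ^ (1 - α)) ?_ ?_ ?_ ?_
    · refine .of_forall fun B => Measurable.aestronglyMeasurable ?_
      have := h.anti.measurable
      fun_prop
    · filter_upwards [eventually_gt_atTop 0] with B hB
      refine .of_forall fun x hx => ?_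
      rw [uIoc_of_le zero_le_one] at hx
      have hx0 := hx.1
      have hBp := Real.rpow_pos_of_pos hB α
      rw [Real.norm_of_nonneg (mul_nonneg hx0.le (mul_nonneg (h.nonneg _) hBp.le))]
      calc x * (G (B * x) * B ^ α) ≤ x * ((M * (B * x) ^ (-α)) * B ^ α) := by
            gcongr; exact hM _ (mul_pos hB hx0)
        _ = M * x ^ (1 - α) := by
            rw [Real.mul_rpow hB.le hx0.le, Real.rpow_neg hB.le, sub_eq_add_neg,
              Real.rpow_add hx0, Real.rpow_one]
            field_simp
    · exact (intervalIntegral.intervalIntegrable_rpow' (by linarith)).const_mul M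
    · refine .of_forall fun x hx => ?_
      rw [uIoc_of_le zero_le_one] at hx
      have hx0 := hx.1
      have h1 := (h.tendsto.comp (tendsto_id.atTop_mul_const hx0)).mul_const (x ^ (1 - α))
      refine h1.congr' ?_
      filter_upwards [eventually_gt_atTop 0] with B hB
      simp only [Function.comp, id]
      have hxp := Real.rpow_pos_of_pos hx0 α
      rw [Real.mul_rpow hB.le hx0.le, Real.rpow_sub hx0, Real.rpow_one]
      field_simp
  have hval : ∫ x in (0 : ℝ)..1, c * x ^ (1 - α) = c / (2 - α) := by
    rw [intervalIntegral.integral_const_mul, integral_rpow (Or.inl (by linarith)),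
      Real.one_rpow, Real.zero_rpow (by linarith), sub_zero, mul_one_div]
    ring
  rw [hval] at key
  refine key.congr' ?_
  filter_upwards [eventually_gt_atTop 0] with B hB
  have h1 := intervalIntegral.integral_comp_mul_left (a := 0) (b := 1)
    (fun y => y * G y) hB.ne'
  rw [mul_zero, mul_one, smul_eq_mul, eq_inv_mul_iff_mul_eq₀ hB.ne'] at h1
  rw [← h1, ← intervalIntegral.integral_const_mul, ← intervalIntegral.integral_div]
  congr 1
  ext x
  have hBp := Real.rpow_pos_of_pos hB α
  rw [Real.rpow_sub hB, Real.rpow_two]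
  field_simp

lemma tendsto_atTop_of_le (h : IsParetoTail G c α) (hc : 0 < c) {t B : ℕ → ℝ}
    (ht : Tendsto t atTop (𝓝 0)) (h1 : ∀ᶠ n in atTop, G (B n + 1) ≤ t n) :
    Tendsto B atTop atTop := by
  refine tendsto_atTop.2 fun M => ?_
  filter_upwards [h1, ht.eventually (eventually_lt_nhds (h.pos hc (M + 1)))] with n hn hn'
  by_contra! hlt
  exact absurd (h.anti (by linarith : B n + 1 ≤ M + 1)) (not_le.2 (hn.trans_lt hn'))

lemma tendsto_quantile_mul (h : IsParetoTail G c α) {t B : ℕ → ℝ} (hB : Tendsto B atTop atTop)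
    (h1 : ∀ᶠ n in atTop, G (B n + 1) ≤ t n) (h2 : ∀ᶠ n in atTop, t n ≤ G (B n - 1)) :
    Tendsto (fun n => t n * B n ^ α) atTop (𝓝 c) := by
  have shift : ∀ d : ℝ, Tendsto (fun n => G (B n + d) * B n ^ α) atTop (𝓝 c) := by
    intro d
    have hBd : Tendsto (fun n => B n + d) atTop atTop := tendsto_atTop_add_const_right _ d hB
    have hr : Tendsto (fun n => B n / (B n + d)) atTop (𝓝 1) := by
      have : Tendsto (fun n => 1 - d / (B n + d)) atTop (𝓝 (1 - 0)) :=
        tendsto_const_nhds.sub (hBd.const_div_atTop d)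
      rw [sub_zero] at this
      refine this.congr' ?_
      filter_upwards [hBd.eventually_gt_atTop 0] with n hn
      field_simp
      ring
    have h3 := (h.tendsto.comp hBd).mul (hr.rpow_const (p := α) (Or.inl one_ne_zero))
    rw [Real.one_rpow, mul_one] at h3
    refine h3.congr' ?_
    filter_upwards [hBd.eventually_gt_atTop 0, hB.eventually_gt_atTop 0] with n hn hn'
    have := Real.rpow_pos_of_pos hn α
    simp only [Function.comp]
    rw [Real.div_rpow hn'.le hn.le]
    field_simp
  refine tendsto_of_tendsto_of_tendsto_of_le_of_le' (shift 1) (shift (-1)) ?_ ?_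
  · filter_upwards [h1, hB.eventually_ge_atTop 0] with n hn hn'
    exact mul_le_mul_of_nonneg_right hn (Real.rpow_nonneg hn' _)
  · filter_upwards [h2, hB.eventually_ge_atTop 0] with n hn hn'
    exact mul_le_mul_of_nonneg_right hn (Real.rpow_nonneg hn' _)

lemma tendsto_ratio (h : IsParetoTail G c α) (hc : 0 < c) (hα : 0 < α) (hα2 : α < 2)
    {t B : ℕ → ℝ} (hB : Tendsto B atTop atTop) (ht : ∀ᶠ n in atTop, 0 < t n)
    (h1 : ∀ᶠ n in atTop, G (B n + 1) ≤ t n) (h2 : ∀ᶠ n in atTop, t n ≤ G (B n - 1)) :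
    Tendsto (fun n => (2 * ∫ y in (0 : ℝ)..B n, y * G y) /
      (2 / (2 - α) * c ^ (2 / α) * t n ^ (1 - 2 / α))) atTop (𝓝 1) := by
  have h3 := ((h.tendsto_integral_mul hα hα2).comp hB).mul
    ((h.tendsto_quantile_mul hB h1 h2).rpow_const (p := 2 / α - 1) (Or.inl hc.ne'))
  have h4 := h3.const_mul (2 / (2 / (2 - α) * c ^ (2 / α)))
  have hcp := Real.rpow_pos_of_pos hc (2 / α)
  have h2α : 0 < 2 - α := by linarith
  have hval : 2 / (2 / (2 - α) * c ^ (2 / α)) * (c / (2 - α) * c ^ (2 / α - 1)) = 1 := by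
    rw [Real.rpow_sub hc, Real.rpow_one]
    field_simp
  rw [hval] at h4
  refine h4.congr' ?_
  filter_upwards [ht, hB.eventually_gt_atTop 0] with n hn hBn
  simp only [Function.comp]
  have e1 : (B n ^ α) ^ (2 / α - 1) = B n ^ (2 - α) := by
    rw [← Real.rpow_mul hBn.le]
    congr 1
    field_simp
  have e2 : t n ^ (2 / α - 1) = (t n ^ (1 - 2 / α))⁻¹ := by
    rw [← Real.rpow_neg hn.le]
    congr 1
    ring
  rw [Real.mul_rpow hn.le (Real.rpow_nonneg hBn.le _), e1, e2]
  have := Real.rpow_pos_of_pos hBn (2 - α)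
  have := Real.rpow_pos_of_pos hn (1 - 2 / α)
  field_simp

end IsParetoTail

/-- The right-continuous generalized inverse `inf {x : F x > u}`. -/
noncomputable def upperQuantile (F : ℝ → ℝ) (u : ℝ) : ℝ := sInf {x : ℝ | u < F x}

namespace IsDistributionFunction

variable {F : ℝ → ℝ} {s t u v x : ℝ}

lemma exists_gt (hF : IsDistributionFunction F) (hu : u < 1) : {x : ℝ | u < F x}.Nonempty :=
  (hF.tendsto_atTop.eventually (eventually_gt_nhds hu)).exists

lemma exists_ge (hF : IsDistributionFunction F) (hu : u < 1) : {x : ℝ | u ≤ F x}.Nonempty :=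
  (hF.tendsto_atTop.eventually (eventually_ge_nhds hu)).exists

lemma bddBelow (hF : IsDistributionFunction F) (hu : 0 < u) : BddBelow {x : ℝ | u ≤ F x} := by
  obtain ⟨y, hy⟩ := (hF.tendsto_atBot.eventually (eventually_lt_nhds hu)).exists
  refine ⟨y, fun x hx => ?_⟩
  by_contra! h
  exact absurd (hF.mono h.le) (not_le.2 (hy.trans_le hx))

lemma bddBelow_lt (hF : IsDistributionFunction F) (hu : 0 < u) : BddBelow {x : ℝ | u < F x} :=
  (hF.bddBelow hu).mono fun x (hx : u < F x) => hx.le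

lemma nonneg (hF : IsDistributionFunction F) (x : ℝ) : 0 ≤ F x :=
  hF.mono.le_of_tendsto hF.tendsto_atBot x

lemma le_one (hF : IsDistributionFunction F) (x : ℝ) : F x ≤ 1 :=
  hF.mono.ge_of_tendsto hF.tendsto_atTop x

lemma quantile_le (hF : IsDistributionFunction F) (hu : 0 < u) (h : u ≤ F x) :
    quantile F u ≤ x :=
  csInf_le (hF.bddBelow hu) h

lemma lt_of_lt_quantile (hF : IsDistributionFunction F) (hu : 0 < u) (h : x < quantile F u) :
    F x < u := by
  by_contra! h'
  exact absurd (hF.quantile_le hu h') (not_le.2 h)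

lemma le_of_quantile_lt (hF : IsDistributionFunction F) (hu : u < 1) (h : quantile F u < x) :
    u ≤ F x := by
  obtain ⟨y, hy, hyx⟩ := exists_lt_of_csInf_lt (hF.exists_ge hu) h
  exact le_trans hy (hF.mono hyx.le)

lemma le_of_lt_upperQuantile (hF : IsDistributionFunction F) (hu : 0 < u)
    (h : x < upperQuantile F u) : F x ≤ u := by
  by_contra! h'
  exact absurd (csInf_le (hF.bddBelow_lt hu) h') (not_le.2 h)

lemma lt_of_upperQuantile_lt (hF : IsDistributionFunction F) (hu : u < 1)
    (h : upperQuantile F u < x) : u < F x := by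
  obtain ⟨y, hy, hyx⟩ := exists_lt_of_csInf_lt (hF.exists_gt hu) h
  exact lt_of_lt_of_le hy (hF.mono hyx.le)

lemma quantile_mono (hF : IsDistributionFunction F) (hu : 0 < u) (huv : u ≤ v) (hv : v < 1) :
    quantile F u ≤ quantile F v :=
  csInf_le_csInf (hF.bddBelow hu) (hF.exists_ge hv)
    fun _ h => huv.trans h

lemma upperQuantile_le_quantile (hF : IsDistributionFunction F) (hu : 0 < u) (huv : u < v)
    (hv : v < 1) : upperQuantile F u ≤ quantile F v :=
  csInf_le_csInf (hF.bddBelow_lt hu) (hF.exists_ge hv)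
    fun _ h => huv.trans_le h

lemma monotone_clampedQuantile (hF : IsDistributionFunction F) (hs : 0 < s) (ht : 0 < t)
    (hst : s < 1 - t) : Monotone (clampedQuantile F s t) := by
  intro u v huv
  refine hF.quantile_mono (lt_max_of_lt_left hs) (by gcongr) ?_
  exact max_lt (by linarith) ((min_le_right _ _).trans_lt (by linarith))

lemma clampedQuantile_eq (hu : s ≤ u) (hu' : u ≤ 1 - t) :
    clampedQuantile F s t u = quantile F u := by
  rw [clampedQuantile, min_eq_left hu', max_eq_right hu]

lemma rightLim_clampedQuantile (hF : IsDistributionFunction F) (hs : 0 < s) (ht : 0 < t)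
    (hst : s < 1 - t) (hsu : s ≤ u) (hut : u < 1 - t) :
    Function.rightLim (clampedQuantile F s t) u = upperQuantile F u := by
  have hm := hF.monotone_clampedQuantile hs ht hst
  apply le_antisymm
  · refine le_of_forall_gt_imp_ge_of_dense fun x hx => ?_
    have hux := hF.lt_of_upperQuantile_lt (by linarith) hx
    have huv : u < min (F x) (1 - t) := lt_min hux hut
    refine (hm.rightLim_le huv).trans ?_
    rw [clampedQuantile_eq (hsu.trans huv.le) (min_le_right _ _)]
    exact hF.quantile_le (by linarith) (min_le_left _ _)
  · refine ge_of_tendsto (hm.tendsto_rightLim u) ?_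
    filter_upwards [Ioo_mem_nhdsGT hut] with v hv
    rw [clampedQuantile_eq (hsu.trans hv.1.le) hv.2.le]
    exact hF.upperQuantile_le_quantile (by linarith) hv.1 (by linarith [hv.2])

lemma rightLim_clampedQuantile_right (hF : IsDistributionFunction F) (hs : 0 < s) (ht : 0 < t)
    (hst : s < 1 - t) :
    Function.rightLim (clampedQuantile F s t) (1 - t) = quantile F (1 - t) := by
  have hm := hF.monotone_clampedQuantile hs ht hst
  apply le_antisymm
  · refine (hm.rightLim_le (lt_add_one (1 - t))).trans_eq ?_
    rw [clampedQuantile, min_eq_right (by linarith), max_eq_right hst.le]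
  · refine (clampedQuantile_eq hst.le le_rfl).symm.le.trans (hm.le_rightLim le_rfl)

/-- On `(s, 1 - t]` the Lebesgue–Stieltjes measure of the quantile function is the image under
`F` of Lebesgue measure. -/
lemma lsMeasure_restrict_eq_map (hF : IsDistributionFunction F) (hs : 0 < s) (ht : 0 < t)
    (hst : s < 1 - t) :
    (lsMeasure (clampedQuantile F s t)).restrict (Ioc s (1 - t)) =
      (volume.restrict (Ioo (upperQuantile F s) (quantile F (1 - t)))).map F := by
  have hm := hF.monotone_clampedQuantile hs ht hst
  have hFm : Measurable F := hF.mono.measurable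
  have : lsMeasure (clampedQuantile F s t) = hm.stieltjesFunction.measure := dif_pos hm
  rw [this]
  have : IsFiniteMeasure (hm.stieltjesFunction.measure.restrict (Ioc s (1 - t))) := ⟨by
    rw [Measure.restrict_apply_univ, StieltjesFunction.measure_Ioc]
    exact ENNReal.ofReal_lt_top⟩
  refine Measure.ext_of_Iic _ _ fun u => ?_
  rw [Measure.restrict_apply measurableSet_Iic, Measure.map_apply hFm measurableSet_Iic,
    Measure.restrict_apply (hFm measurableSet_Iic)]
  have hfs : hm.stieltjesFunction s = upperQuantile F s :=
    hF.rightLim_clampedQuantile hs ht hst le_rfl hst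
  rcases le_or_gt u s with hus | hus
  · have e1 : Iic u ∩ Ioc s (1 - t) = ∅ := by
      ext x
      simp only [mem_inter_iff, mem_Iic, mem_Ioc, mem_empty_iff_false, iff_false]
      intro h
      linarith [h.1, h.2.1]
    have e2 : F ⁻¹' Iic u ∩ Ioo (upperQuantile F s) (quantile F (1 - t)) = ∅ := by
      ext x
      simp only [mem_inter_iff, mem_preimage, mem_Iic, mem_Ioo, mem_empty_iff_false, iff_false]
      intro h
      linarith [h.1, hF.lt_of_upperQuantile_lt (by linarith) h.2.1]
    rw [e1, e2, measure_empty, measure_empty]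
  rcases le_or_gt (1 - t) u with hut | hut
  · have e1 : Iic u ∩ Ioc s (1 - t) = Ioc s (1 - t) :=
      inter_eq_right.2 fun x hx => hx.2.trans hut
    have e2 : F ⁻¹' Iic u ∩ Ioo (upperQuantile F s) (quantile F (1 - t)) =
        Ioo (upperQuantile F s) (quantile F (1 - t)) :=
      inter_eq_right.2 fun x hx => (hF.lt_of_lt_quantile (by linarith) hx.2).le.trans hut
    have hft : hm.stieltjesFunction (1 - t) = quantile F (1 - t) :=
      hF.rightLim_clampedQuantile_right hs ht hst
    rw [e1, e2, StieltjesFunction.measure_Ioc, hfs, hft, Real.volume_Ioo]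
  · have e1 : Iic u ∩ Ioc s (1 - t) = Ioc s u := by
      ext x
      simp only [mem_inter_iff, mem_Iic, mem_Ioc]
      exact ⟨fun h => ⟨h.2.1, h.1⟩, fun h => ⟨h.2, h.1, h.2.trans hut.le⟩⟩
    have hfu : hm.stieltjesFunction u = upperQuantile F u :=
      hF.rightLim_clampedQuantile hs ht hst hus.le hut
    rw [e1, StieltjesFunction.measure_Ioc, hfs, hfu]
    apply le_antisymm
    · rw [← Real.volume_Ioo]
      refine measure_mono fun x hx => ⟨?_, hx.1, hx.2.trans_le ?_⟩
      · exact hF.le_of_lt_upperQuantile (by linarith) hx.2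
      · exact hF.upperQuantile_le_quantile (by linarith) hut (by linarith)
    · rw [← Real.volume_Ioc]
      refine measure_mono fun x hx => ⟨hx.2.1, ?_⟩
      by_contra! h
      exact absurd (hF.lt_of_upperQuantile_lt (by linarith) h) (not_lt.2 hx.1)

lemma sigmaSq_eq_integral (hF : IsDistributionFunction F) (hs : 0 < s) (ht : 0 < t)
    (hst : s < 1 - t) :
    sigmaSq F s t = ∫ x in Ioc (upperQuantile F s) (quantile F (1 - t)),
      ∫ y in Ioc (upperQuantile F s) (quantile F (1 - t)), (min (F x) (F y) - F x * F y) := by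
  have hFm : Measurable F := hF.mono.measurable
  rw [sigmaSq, hF.lsMeasure_restrict_eq_map hs ht hst,
    Measure.restrict_congr_set (Ioo_ae_eq_Ioc (μ := volume))]
  set μ := (volume : Measure ℝ).restrict (Ioc (upperQuantile F s) (quantile F (1 - t)))
  have h1 : ∀ u : ℝ, ∫ v, (min u v - u * v) ∂(μ.map F) = ∫ y, (min u (F y) - u * F y) ∂μ := by
    intro u
    rw [integral_map hFm.aemeasurable]
    exact Continuous.aestronglyMeasurable (by fun_prop)
  simp_rw [h1]
  rw [integral_map hFm.aemeasurable]
  have h2 : StronglyMeasurable fun p : ℝ × ℝ => min p.1 (F p.2) - p.1 * F p.2 :=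
    Measurable.stronglyMeasurable (by fun_prop)
  exact h2.integral_prod_right'.aestronglyMeasurable

end IsDistributionFunction

/-- The signed tail of `F`: the survival function on the right, `-F` on the left. -/
noncomputable def signedTail (F : ℝ → ℝ) (x : ℝ) : ℝ := if 0 < x then 1 - F x else -F x

/-- The part of the covariance kernel `F (min x y) - F x F y` whose mass is attributed to `y`;
`p` tells whether the diagonal is included. -/
noncomputable def tailKernel (F : ℝ → ℝ) (p : Prop) (z : ℝ × ℝ) : ℝ :=
  {z : ℝ × ℝ | 0 < z.1 ∧ (z.1 < z.2 ∨ p ∧ z.1 = z.2)}.indicator (fun z => 1 - F z.2) z +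
    {z : ℝ × ℝ | z.1 ≤ 0 ∧ (z.2 < z.1 ∨ p ∧ z.1 = z.2)}.indicator (fun z => F z.2) z

lemma min_sub_mul_eq_tailKernel {F : ℝ → ℝ} (hF : Monotone F) (x y : ℝ) :
    min (F x) (F y) - F x * F y =
      tailKernel F False (x, y) + tailKernel F True (y, x) - signedTail F x * signedTail F y := by
  simp only [tailKernel, signedTail, indicator_apply, mem_ofPred_eq, false_and, or_false, true_and]
  rcases lt_trichotomy x y with h | h | h
  · rw [min_eq_left (hF h.le)]
    by_cases hx : 0 < x
    · have hy := hx.trans h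
      simp [hx, hy, h, h.not_gt, h.ne', hx.not_ge, hy.not_ge]
      ring
    · by_cases hy : 0 < y
      · simp [hx, hy, h, h.not_gt, h.ne', hy.not_ge]
        ring
      · simp [hx, hy, h, h.not_gt, h.ne', not_lt.1 hy]
  · subst h
    by_cases hx : 0 < x
    · simp [hx, hx.not_ge]
      ring
    · simp [hx, not_lt.1 hx]
  · rw [min_eq_right (hF h.le)]
    by_cases hy : 0 < y
    · have hx := hy.trans h
      simp [hx, hy, h, h.not_gt, h.ne, hx.not_ge, hy.not_ge]
      ring
    · by_cases hx : 0 < x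
      · simp [hx, hy, h, h.not_gt, h.ne, hx.not_ge]
        ring
      · simp [hx, hy, h, h.not_gt, h.ne, not_lt.1 hx]

lemma measurable_signedTail {F : ℝ → ℝ} (hF : Measurable F) : Measurable (signedTail F) :=
  Measurable.ite measurableSet_Ioi (by fun_prop) (by fun_prop)

lemma measurable_tailKernel {F : ℝ → ℝ} (hF : Measurable F) (p : Prop) :
    Measurable (tailKernel F p) := by
  have hd : MeasurableSet {z : ℝ × ℝ | p ∧ z.1 = z.2} :=
    (MeasurableSet.const p).inter (measurableSet_eq_fun measurable_fst measurable_snd)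
  refine Measurable.add (Measurable.indicator (by fun_prop) ?_)
    (Measurable.indicator (by fun_prop) ?_)
  · exact (measurableSet_lt measurable_const measurable_fst).inter
      ((measurableSet_lt measurable_fst measurable_snd).union hd)
  · exact (measurableSet_le measurable_fst measurable_const).inter
      ((measurableSet_lt measurable_snd measurable_fst).union hd)

lemma abs_signedTail_le {F : ℝ → ℝ} (h0 : ∀ x, 0 ≤ F x) (h1 : ∀ x, F x ≤ 1) (x : ℝ) :
    |signedTail F x| ≤ 1 := by
  rw [signedTail]
  split_ifs <;> rw [abs_le] <;> constructor <;> linarith [h0 x, h1 x]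

lemma abs_tailKernel_le {F : ℝ → ℝ} (h0 : ∀ x, 0 ≤ F x) (h1 : ∀ x, F x ≤ 1) (p : Prop)
    (z : ℝ × ℝ) : |tailKernel F p z| ≤ 2 := by
  classical
  simp only [tailKernel, indicator_apply]
  split_ifs <;> rw [abs_le] <;> constructor <;> linarith [h0 z.2, h1 z.2]

lemma integral_tailKernel {F : ℝ → ℝ} {A B y : ℝ} (p : Prop) (hA : A ≤ 0) (hB : 0 ≤ B)
    (hy : y ∈ Ioc A B) :
    ∫ x in Ioc A B, tailKernel F p (x, y) = y * signedTail F y := by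
  classical
  rw [signedTail]
  split_ifs with h
  · have e : ∀ᵐ x ∂volume.restrict (Ioc A B),
        tailKernel F p (x, y) = (Ioc 0 y).indicator (fun _ => 1 - F y) x := by
      filter_upwards [(measure_eq_zero_iff_ae_notMem.1 (measure_singleton (y : ℝ)))
        |> ae_restrict_of_ae (s := Ioc A B)] with x hx
      have hxy : x ≠ y := hx
      have hlt : x < y ↔ x ≤ y := ⟨le_of_lt, fun h => lt_of_le_of_ne h hxy⟩
      have : ¬ (x ≤ 0 ∧ y < x) := fun h' => by linarith [h'.1, h'.2]
      simp only [tailKernel, indicator_apply, mem_ofPred_eq, hxy, and_false, or_false, mem_Ioc, hlt,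
        this, if_false, add_zero]
    rw [integral_congr_ae e, integral_indicator measurableSet_Ioc,
      Measure.restrict_restrict measurableSet_Ioc,
      inter_eq_left.2 (Ioc_subset_Ioc hA hy.2), setIntegral_const]
    simp [h.le]
  · have hy0 := not_lt.1 h
    have e : ∀ᵐ x ∂volume.restrict (Ioc A B),
        tailKernel F p (x, y) = (Ioc y 0).indicator (fun _ => F y) x := by
      filter_upwards [(measure_eq_zero_iff_ae_notMem.1 (measure_singleton (y : ℝ)))
        |> ae_restrict_of_ae (s := Ioc A B)] with x hx
      have hxy : x ≠ y := hx
      have : ¬ (0 < x ∧ x < y) := fun h' => by linarith [h'.1, h'.2]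
      simp only [tailKernel, indicator_apply, mem_ofPred_eq, hxy, and_false, or_false, mem_Ioc,
        this, if_false, zero_add, and_comm (b := x ≤ 0)]
    rw [integral_congr_ae e, integral_indicator measurableSet_Ioc,
      Measure.restrict_restrict measurableSet_Ioc,
      inter_eq_left.2 (Ioc_subset_Ioc hy.1.le hB), setIntegral_const]
    simp [hy0]

/-- Hoeffding's covariance double integral as a second moment minus a squared mean. -/
lemma integral_integral_min_sub_mul {F : ℝ → ℝ} (hF : Monotone F) (h0 : ∀ x, 0 ≤ F x)
    (h1 : ∀ x, F x ≤ 1) {A B : ℝ} (hA : A ≤ 0) (hB : 0 ≤ B) :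
    ∫ x in Ioc A B, ∫ y in Ioc A B, (min (F x) (F y) - F x * F y) =
      2 * (∫ y in Ioc A B, y * signedTail F y) - (∫ y in Ioc A B, signedTail F y) ^ 2 := by
  set μ := (volume : Measure ℝ).restrict (Ioc A B) with hμ
  have hg : Integrable (signedTail F) μ :=
    .of_bound (measurable_signedTail hF.measurable).aestronglyMeasurable 1
      (.of_forall fun x => abs_signedTail_le h0 h1 x)
  have hT : ∀ p, Integrable (tailKernel F p) (μ.prod μ) := fun p =>
    .of_bound (measurable_tailKernel hF.measurable p).aestronglyMeasurable 2
      (.of_forall fun z => abs_tailKernel_le h0 h1 p z)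
  have hinner : ∀ p, ∫ y, ∫ x, tailKernel F p (x, y) ∂μ ∂μ = ∫ y, y * signedTail F y ∂μ :=
    fun p => setIntegral_congr_fun measurableSet_Ioc fun y hy => integral_tailKernel p hA hB hy
  have hsum := ((hT False).add (hT True).swap).sub (hg.mul_prod hg)
  have hprod := integral_prod _ hsum
  have hsplit : ∫ z, ((tailKernel F False + tailKernel F True ∘ Prod.swap) -
      fun z : ℝ × ℝ => signedTail F z.1 * signedTail F z.2) z ∂(μ.prod μ) =
      ∫ y, y * signedTail F y ∂μ + ∫ y, y * signedTail F y ∂μ -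
        (∫ y, signedTail F y ∂μ) * ∫ y, signedTail F y ∂μ := by
    rw [integral_sub' ((hT False).add (hT True).swap) (hg.mul_prod hg),
      integral_add' (hT False) (hT True).swap, integral_prod_mul,
      integral_prod_symm _ (hT False), integral_prod _ (hT True).swap]
    simp only [Function.comp, Prod.swap_prod_mk]
    rw [hinner, hinner]
  simp_rw [min_sub_mul_eq_tailKernel hF]
  refine hprod.symm.trans (hsplit.trans ?_)
  ring

lemma setIntegral_mul_signedTail {F φ : ℝ → ℝ} (hF : Monotone F) (hφ : Continuous φ)
    {A B : ℝ} (hA : A ≤ 0) (hB : 0 ≤ B) :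
    ∫ y in Ioc A B, φ y * signedTail F y =
      (∫ y in (0 : ℝ)..B, φ y * (1 - F y)) - ∫ y in (0 : ℝ)..-A, φ (-y) * F (-y) := by
  have hG : Antitone fun y => 1 - F y := fun x y hxy => sub_le_sub_left (hF hxy) 1
  have i1 : IntervalIntegrable (fun y => φ y * (1 - F y)) volume 0 B :=
    hG.intervalIntegrable.continuousOn_mul hφ.continuousOn
  have i2 : IntervalIntegrable (fun y => φ y * -F y) volume A 0 :=
    (hF.neg.intervalIntegrable).continuousOn_mul hφ.continuousOn
  have e1 : EqOn (fun y => φ y * (1 - F y)) (fun y => φ y * signedTail F y) (Ioc 0 B) :=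
    fun y hy => by simp [signedTail, hy.1]
  have e2 : EqOn (fun y => φ y * -F y) (fun y => φ y * signedTail F y) (Ioc A 0) :=
    fun y hy => by simp [signedTail, hy.2.not_gt]
  rw [← uIoc_of_le hB] at e1
  rw [← uIoc_of_le hA] at e2
  rw [← intervalIntegral.integral_of_le (hA.trans hB),
    ← intervalIntegral.integral_add_adjacent_intervals (i2.congr e2) (i1.congr e1),
    ← intervalIntegral.integral_congr_ae (.of_forall e1), ← intervalIntegral.integral_congr_ae (.of_forall e2)]
  have h := intervalIntegral.integral_comp_neg (a := 0) (b := -A) (fun y => φ y * -F y)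
  rw [neg_neg, neg_zero] at h
  rw [← h]
  simp only [mul_neg, intervalIntegral.integral_neg]
  ring

lemma tendsto_sub_sq_div_add {p q P Q E : ℕ → ℝ} {K : ℝ}
    (hp : Tendsto (fun n => p n / P n) atTop (𝓝 1)) (hq : Tendsto (fun n => q n / Q n) atTop (𝓝 1))
    (hP : Tendsto P atTop atTop) (hQ : ∀ᶠ n in atTop, 0 < Q n)
    (hE : ∀ᶠ n in atTop, |E n| ≤ K) :
    Tendsto (fun n => (p n + q n - E n ^ 2) / (P n + Q n)) atTop (𝓝 1) := by
  have hlim : Tendsto (fun n => |p n / P n - 1| + |q n / Q n - 1| + K ^ 2 / P n) atTop (𝓝 0) := by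
    have h := ((hp.sub_const 1).abs.add (hq.sub_const 1).abs).add (hP.const_div_atTop (K ^ 2))
    simpa using h
  rw [tendsto_iff_norm_sub_tendsto_zero]
  refine squeeze_zero' (.of_forall fun n => norm_nonneg _) ?_ hlim
  filter_upwards [hP.eventually_gt_atTop 0, hQ, hE] with n hPn hQn hEn
  have hS : 0 < P n + Q n := add_pos hPn hQn
  have e : (p n + q n - E n ^ 2) / (P n + Q n) - 1 =
      (p n / P n - 1) * (P n / (P n + Q n)) + (q n / Q n - 1) * (Q n / (P n + Q n)) -
        E n ^ 2 / (P n + Q n) := by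
    field_simp
    ring
  have a1 : |P n / (P n + Q n)| ≤ 1 := by
    rw [abs_of_pos (div_pos hPn hS), div_le_one hS]
    linarith
  have a2 : |Q n / (P n + Q n)| ≤ 1 := by
    rw [abs_of_pos (div_pos hQn hS), div_le_one hS]
    linarith
  have a3 : |E n ^ 2 / (P n + Q n)| ≤ K ^ 2 / P n := by
    rw [abs_of_nonneg (by positivity), ← sq_abs (E n)]
    gcongr
    linarith
  rw [e, Real.norm_eq_abs]
  refine (abs_sub _ _).trans (add_le_add ((abs_add_le _ _).trans (add_le_add ?_ ?_)) a3)
  · rw [abs_mul]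
    exact mul_le_of_le_one_right (abs_nonneg _) a1
  · rw [abs_mul]
    exact mul_le_of_le_one_right (abs_nonneg _) a2

lemma IsDistributionFunction.isParetoTail_right {F : ℝ → ℝ} {c α b β : ℝ}
    (hF : IsDistributionFunction F) (hc : 0 < c) (hβ : 0 < β)
    (h : RightTailSecondOrder F c α b β) : IsParetoTail (fun x => 1 - F x) c α where
  anti _ _ hxy := sub_le_sub_left (hF.mono hxy) 1
  nonneg x := sub_nonneg.2 (hF.le_one x)
  le_one x := by linarith [hF.nonneg x]
  tendsto := tendsto_mul_rpow_of_secondOrder hc hβ h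

lemma IsDistributionFunction.isParetoTail_left {F : ℝ → ℝ} {c α b β : ℝ}
    (hF : IsDistributionFunction F) (hc : 0 < c) (hβ : 0 < β)
    (h : LeftTailSecondOrder F c α b β) : IsParetoTail (fun x => F (-x)) c α where
  anti _ _ hxy := hF.mono (neg_le_neg hxy)
  nonneg _ := hF.nonneg _
  le_one _ := hF.le_one _
  tendsto := tendsto_mul_rpow_of_secondOrder hc hβ h

lemma IsParetoTail.abs_integral_le {G : ℝ → ℝ} {c α B : ℝ} (h : IsParetoTail G c α)
    (hα : 1 < α) (hB : 0 ≤ B) : |∫ y in (0 : ℝ)..B, G y| ≤ ∫ y in Ioi 0, G y := by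
  rw [intervalIntegral.integral_of_le hB, abs_of_nonneg (integral_nonneg h.nonneg)]
  exact setIntegral_mono_set (h.integrableOn_Ioi hα) (.of_forall h.nonneg)
    Ioc_subset_Ioi_self.eventuallyLE

/-- under the second-order tail conditions with `α_R < 2` and `α_L < 2`,
there are strictly positive finite constants `C_R` (depending only on `c_R` and `α_R`)
and `C_L` (depending only on `c_L` and `α_L`) such that
`σ²(m/n, k/n) / (C_R (k/n)^(1 - 2/α_R) + C_L (m/n)^(1 - 2/α_L)) → 1` as `n → ∞`. -/
theorem sigmaSq_ratio_tendsto_of_lt_two_lt_two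
    (cR αR cL αL : ℝ) (hcR : 0 < cR) (hαR1 : 1 < αR) (hαR2 : αR < 2)
    (hcL : 0 < cL) (hαL1 : 1 < αL) (hαL2 : αL < 2) :
    ∃ CR CL : ℝ, 0 < CR ∧ 0 < CL ∧
      ∀ (F : ℝ → ℝ) (bR bL βR βL : ℝ) (m k : ℕ → ℕ),
        IsDistributionFunction F →
        bR ≠ 0 → bL ≠ 0 → 0 < βR → 0 < βL →
        RightTailSecondOrder F cR αR bR βR →
        LeftTailSecondOrder F cL αL bL βL →
        Tendsto m atTop atTop →
        Tendsto (fun n : ℕ => (m n : ℝ) / n) atTop (nhds 0) →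
        Tendsto k atTop atTop →
        Tendsto (fun n : ℕ => (k n : ℝ) / n) atTop (nhds 0) →
        Tendsto
          (fun n : ℕ =>
            sigmaSq F ((m n : ℝ) / n) ((k n : ℝ) / n) /
              (CR * ((k n : ℝ) / n) ^ (1 - 2 / αR) +
                CL * ((m n : ℝ) / n) ^ (1 - 2 / αL)))
          atTop (nhds 1) := by
  have hR2 : 0 < 2 - αR := by linarith
  have hL2 : 0 < 2 - αL := by linarith
  have hCR : 0 < 2 / (2 - αR) * cR ^ (2 / αR) := by positivity
  have hCL : 0 < 2 / (2 - αL) * cL ^ (2 / αL) := by positivity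
  refine ⟨_, _, hCR, hCL, ?_⟩
  intro F bR bL βR βL m k hF _ _ hβR hβL hR hL hm hm0 hk hk0
  have hG := hF.isParetoTail_right hcR hβR hR
  have hH := hF.isParetoTail_left hcL hβL hL
  set s : ℕ → ℝ := fun n => (m n : ℝ) / n with hs_def
  set t : ℕ → ℝ := fun n => (k n : ℝ) / n with ht_def
  have hs : ∀ᶠ n in atTop, 0 < s n := by
    filter_upwards [hm.eventually_gt_atTop 0, eventually_gt_atTop 0] with n h1 h2
    exact div_pos (Nat.cast_pos.2 h1) (Nat.cast_pos.2 h2)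
  have ht : ∀ᶠ n in atTop, 0 < t n := by
    filter_upwards [hk.eventually_gt_atTop 0, eventually_gt_atTop 0] with n h1 h2
    exact div_pos (Nat.cast_pos.2 h1) (Nat.cast_pos.2 h2)
  have hst : ∀ᶠ n in atTop, s n < 1 - t n := by
    have h : Tendsto (fun n => s n + t n) atTop (𝓝 (0 + 0)) := hm0.add hk0
    rw [add_zero] at h
    filter_upwards [h.eventually (eventually_lt_nhds one_pos)] with n hn
    linarith
  set B : ℕ → ℝ := fun n => quantile F (1 - t n) with hB_def
  set A : ℕ → ℝ := fun n => upperQuantile F (s n) with hA_def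
  have hB1 : ∀ᶠ n in atTop, 1 - F (B n + 1) ≤ t n := by
    filter_upwards [ht] with n h1
    linarith [hF.le_of_quantile_lt (by linarith) (lt_add_one (B n))]
  have hB2 : ∀ᶠ n in atTop, t n ≤ 1 - F (B n - 1) := by
    filter_upwards [hs, hst] with n h1 h2
    linarith [hF.lt_of_lt_quantile (by linarith) (sub_one_lt (B n))]
  have hA1 : ∀ᶠ n in atTop, F (-(-A n + 1)) ≤ s n := by
    filter_upwards [hs] with n h1
    exact hF.le_of_lt_upperQuantile h1 (by linarith : -(-A n + 1) < A n)
  have hA2 : ∀ᶠ n in atTop, s n ≤ F (-(-A n - 1)) := by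
    filter_upwards [ht, hst] with n h1 h2
    exact (hF.lt_of_upperQuantile_lt (by linarith) (by linarith : A n < -(-A n - 1))).le
  have hB : Tendsto B atTop atTop := hG.tendsto_atTop_of_le hcR hk0 hB1
  have hA : Tendsto (fun n => -A n) atTop atTop := hH.tendsto_atTop_of_le hcL hm0 hA1
  have hp := hG.tendsto_ratio hcR (by linarith) hαR2 hB ht hB1 hB2
  have hq := hH.tendsto_ratio hcL (by linarith) hαL2 hA hs hA1 hA2
  have hP : Tendsto (fun n => 2 / (2 - αR) * cR ^ (2 / αR) * t n ^ (1 - 2 / αR)) atTop atTop := by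
    refine Tendsto.const_mul_atTop hCR ?_
    have hneg : 1 - 2 / αR < 0 := by
      rw [sub_neg, lt_div_iff₀ (by linarith)]
      linarith
    exact (tendsto_rpow_neg_nhdsGT_zero hneg).comp (tendsto_nhdsWithin_iff.2 ⟨hk0, ht⟩)
  have hQ : ∀ᶠ n in atTop, 0 < 2 / (2 - αL) * cL ^ (2 / αL) * s n ^ (1 - 2 / αL) := by
    filter_upwards [hs] with n hn
    exact mul_pos hCL (Real.rpow_pos_of_pos hn _)
  have hE : ∀ᶠ n in atTop, |(∫ y in (0 : ℝ)..B n, (1 - F y)) - ∫ y in (0 : ℝ)..-A n, F (-y)| ≤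
      (∫ y in Ioi 0, (1 - F y)) + ∫ y in Ioi 0, F (-y) := by
    filter_upwards [hB.eventually_ge_atTop 0, hA.eventually_ge_atTop 0] with n h1 h2
    exact (abs_sub _ _).trans
      (add_le_add (hG.abs_integral_le hαR1 h1) (hH.abs_integral_le hαL1 h2))
  refine (tendsto_sub_sq_div_add hp hq hP hQ hE).congr' ?_
  filter_upwards [hs, ht, hst, hB.eventually_ge_atTop 0, hA.eventually_ge_atTop 0]
    with n h1 h2 h3 hBn hAn
  have hAn' : A n ≤ 0 := neg_nonneg.1 hAn
  have e1 := setIntegral_mul_signedTail hF.mono continuous_id hAn' hBn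
  have e2 := setIntegral_mul_signedTail hF.mono (continuous_const (y := (1 : ℝ))) hAn' hBn
  simp only [id, one_mul, neg_mul, intervalIntegral.integral_neg, sub_neg_eq_add] at e1 e2
  rw [hF.sigmaSq_eq_integral h1 h2 h3,
    integral_integral_min_sub_mul hF.mono hF.nonneg hF.le_one hAn' hBn, e1, e2, mul_add]
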